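/- Let q > 2 be a prime power and let F_q be the finite field with q elements. Let f be a nonconstant polynomial in F_q[x] and let R = F_q[x]/(f) be the corresponding (nonzero, proper) quotient ring. Then D(S_R) = D(U(S_R)), where S_R denotes the multiplicative semigroup of R and U(S_R) denotes its group of units. -/

import Mathlib

/-- A sequence (finite multiset) `T` over a commutative semigroup with identity is
reducible if it has a proper subsequence whose product equals the product of `T`. -/
def MulReducible {M : Type*} [CommMonoid M] (T : Multiset M) : Prop :=
  ∃ T' : Multiset M, T' ≤ T ∧ T' ≠ T ∧ T'.prod = T.prod

/-- The Davenport constant of a commutative semigroup with identity: the least positive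
integer `ℓ` such that every sequence of length at least `ℓ` is reducible. -/
noncomputable def Davenport (M : Type*) [CommMonoid M] : ℕ :=
  sInf {n : ℕ | 1 ≤ n ∧ ∀ T : Multiset M, n ≤ Multiset.card T → MulReducible T}

theorem Multiset.exists_le_map_eq_of_le_map {α β : Type*} (f : α → β) (s : Multiset α) :
    ∀ t ≤ s.map f, ∃ s' ≤ s, s'.map f = t := by
  classical
  induction s using Multiset.induction with
  | empty => intro t ht; exact ⟨0, le_rfl, by simpa [eq_comm] using ht⟩
  | cons a s ih =>
    intro t ht
    rw [Multiset.map_cons] at ht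
    by_cases hat : f a ∈ t
    · obtain ⟨t, rfl⟩ := Multiset.exists_cons_of_mem hat
      obtain ⟨s', hs', rfl⟩ := ih t ((Multiset.cons_le_cons_iff _).1 ht)
      exact ⟨a ::ₘ s', (Multiset.cons_le_cons_iff _).2 hs', Multiset.map_cons _ _ _⟩
    · obtain ⟨s', hs', rfl⟩ := ih t ((Multiset.le_cons_of_notMem hat).1 ht)
      exact ⟨s', hs'.trans (Multiset.le_cons_self _ _), rfl⟩

/-- Every sequence of length at least `n` over `G` has a nonempty subsequence whose product lies
in `H`; that is, `n` is at least the Davenport constant of `G ⧸ H`. -/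
def Subgroup.ForcesProd {G : Type*} [CommGroup G] (H : Subgroup G) (n : ℕ) : Prop :=
  ∀ T : Multiset G, n ≤ Multiset.card T → ∃ T' ≤ T, T' ≠ 0 ∧ T'.prod ∈ H

theorem Subgroup.ForcesProd.of_lt {G : Type*} [CommGroup G] {H K : Subgroup G} {n : ℕ}
    (h : H.ForcesProd (n + 1)) (hHK : H < K) : K.ForcesProd n := by
  classical
  intro T hT
  obtain ⟨k, hkK, hkH⟩ := SetLike.exists_of_lt hHK
  obtain ⟨T', hle, hne, hprod⟩ := h (k ::ₘ T) (by simpa using hT)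
  by_cases hk : k ∈ T'
  · obtain ⟨T', rfl⟩ := Multiset.exists_cons_of_mem hk
    refine ⟨T', (Multiset.cons_le_cons_iff _).1 hle, ?_, ?_⟩
    · rintro rfl
      exact hkH (by simpa using hprod)
    · rw [Multiset.prod_cons] at hprod
      exact (Subgroup.mul_mem_cancel_left K hkK).1 (hHK.le hprod)
  · exact ⟨T', (Multiset.le_cons_of_notMem hk).1 hle, hne, hHK.le hprod⟩

theorem exists_pow_succ_mul_self_eq {M : Type*} [Monoid M] [Finite M] (t : M) :
    ∃ n : ℕ, t ^ (n + 1) * t ^ (n + 1) = t ^ (n + 1) := by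
  obtain ⟨i, j, hne, hij⟩ := Finite.exists_ne_map_eq_of_infinite (fun n : ℕ => t ^ (n + 1))
  wlog hlt : i < j generalizing i j
  · exact this j i hne.symm hij.symm (by omega)
  obtain ⟨d, rfl⟩ := Nat.exists_eq_add_of_lt hlt
  have key (m : ℕ) : t ^ (i + 1 + m) = t ^ (i + 1 + m + (d + 1)) := by
    rw [pow_add, show t ^ (i + 1) = t ^ (i + d + 1 + 1) from hij, ← pow_add]
    congr 1; omega
  have key' (r m : ℕ) : t ^ (i + 1 + m) = t ^ (i + 1 + m + r * (d + 1)) := by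
    induction r with
    | zero => simp
    | succ r ih =>
      rw [ih, show i + 1 + m + r * (d + 1) = i + 1 + (m + r * (d + 1)) by omega, key]
      congr 1; ring
  refine ⟨i + 1 + (i + 1) * d - 1, ?_⟩
  have h := key' (i + 1) ((i + 1) * d)
  rw [Nat.sub_add_cancel (by omega), ← pow_add]
  refine Eq.trans ?_ h.symm
  congr 1; ring

section FiniteRing

variable {R : Type*} [CommRing R] [Finite R]

theorem exists_unit_mul_eq_of_dvd {a t : R} (h : a * t ∣ a) : ∃ u : Rˣ, a * u = a * t := by
  obtain ⟨s, hs⟩ := h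
  obtain ⟨n, hn⟩ := exists_pow_succ_mul_self_eq t
  have hpow (m : ℕ) : a = a * t ^ m * s ^ m := by
    induction m with
    | zero => simp
    | succ m ih =>
      calc a = a * t * s := hs
        _ = (a * t ^ m * s ^ m) * t * s := by rw [← ih]
        _ = _ := by ring
  have hae : a * t ^ (n + 1) = a := by
    calc a * t ^ (n + 1) = (a * t ^ (n + 1) * s ^ (n + 1)) * t ^ (n + 1) := by rw [← hpow]
      _ = a * (t ^ (n + 1) * t ^ (n + 1)) * s ^ (n + 1) := by ring
      _ = a := by rw [hn, ← hpow]
  have hu : (t * t ^ (n + 1) + (1 - t ^ (n + 1))) *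
      (t ^ n * t ^ (n + 1) + (1 - t ^ (n + 1))) = 1 := by
    generalize he : t ^ (n + 1) = e at *
    have htn : t * t ^ n = e := by rw [← he]; ring
    linear_combination (e * e) * htn + (e + 2 - t - t ^ n) * hn
  refine ⟨Units.mkOfMulEqOne _ _ hu, ?_⟩
  rw [Units.val_mkOfMulEqOne]
  linear_combination (t - 1) * hae

theorem exists_annihilator_unit_of_not_dvd {c : R} (hc : IsUnit c) (hc1 : IsUnit (c - 1))
    {a b : R} (h : ¬ a * b ∣ a) : ∃ u : Rˣ, u * (a * b) = a * b ∧ u * a ≠ a := by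
  classical
  obtain ⟨n, hn⟩ := exists_pow_succ_mul_self_eq b
  have hae : a * (1 - b ^ (n + 1)) ≠ 0 := fun h0 =>
    h ⟨b ^ n, by linear_combination h0⟩
  have hex : ∃ k, a * b ^ (k + 1) * (1 - b ^ (n + 1)) = 0 :=
    ⟨n, by linear_combination - a * hn⟩
  obtain ⟨k, hk, hmin⟩ := Nat.findX hex
  obtain _ | k := k
  · obtain ⟨d, hd⟩ := hc
    have hinv : (d : R) * (↑d⁻¹ : R) = 1 := d.mul_inv
    have hu : (1 + (c - 1) * (1 - b ^ (n + 1))) *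
        (1 + ((↑d⁻¹ : R) - 1) * (1 - b ^ (n + 1))) = 1 := by
      rw [← hd]
      generalize b ^ (n + 1) = e at *
      linear_combination (1 - e) ^ 2 * hinv + (2 - d - ↑d⁻¹) * hn
    refine ⟨Units.mkOfMulEqOne _ _ hu, ?_, ?_⟩
    · rw [Units.val_mkOfMulEqOne]
      linear_combination (c - 1) * hk
    · rw [Units.val_mkOfMulEqOne]
      intro h0
      refine hae (hc1.mul_right_eq_zero.1 ?_)
      linear_combination h0
  · have hnil : IsNilpotent (b ^ (k + 1) * (1 - b ^ (n + 1))) := by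
      have : IsNilpotent (b * (1 - b ^ (n + 1))) := by
        refine ⟨n + 1, ?_⟩
        rw [mul_pow, pow_succ (1 - b ^ (n + 1))]
        linear_combination (-(1 - b ^ (n + 1)) ^ n) * hn
      rw [pow_succ, mul_assoc]
      exact Commute.isNilpotent_mul_left (Commute.all _ _) this
    obtain ⟨u, hu⟩ := hnil.isUnit_one_add
    refine ⟨u, ?_, ?_⟩
    · rw [hu]
      linear_combination hk
    · rw [hu]
      intro h0
      refine hmin k (by omega) ?_
      linear_combination h0

theorem exists_prod_eq_of_forcesProd {c : R} (hc : IsUnit c) (hc1 : IsUnit (c - 1)) (n : ℕ) :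
    ∀ (a : R), (MulAction.stabilizer Rˣ a).ForcesProd n → ∀ T : Multiset R,
      n ≤ Multiset.card T → ∃ T' ≤ T, T' ≠ T ∧ a * T'.prod = a * T.prod := by
  classical
  induction n with
  | zero =>
    intro a ha
    obtain ⟨T', hle, hne, -⟩ := ha 0 (by simp)
    exact absurd (Multiset.le_zero.1 hle) hne
  | succ n ih =>
    intro a ha T hT
    by_cases hdvd : ∀ b ∈ T, a * b ∣ a
    · have hunit : ∀ b : R, ∃ u : Rˣ, b ∈ T → a * u = a * b := fun b => by
        by_cases hb : b ∈ T
        · obtain ⟨u, hu⟩ := exists_unit_mul_eq_of_dvd (hdvd b hb)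
          exact ⟨u, fun _ => hu⟩
        · exact ⟨1, fun h => absurd h hb⟩
      choose v hv using hunit
      have hprod (S : Multiset R) : S ≤ T → a * S.prod = a * ((S.map v).prod : Rˣ) := by
        induction S using Multiset.induction with
        | empty => simp
        | cons b S ihS =>
          intro hS
          have h1 := ihS ((Multiset.le_cons_self _ _).trans hS)
          have h2 := hv b (Multiset.mem_of_le hS (Multiset.mem_cons_self _ _))
          simp only [Multiset.prod_cons, Multiset.map_cons, Units.val_mul]
          linear_combination b * h1 - ((S.map v).prod : Rˣ) * h2
      obtain ⟨V, hV, hV0, hVa⟩ := ha (T.map v) (by simpa using hT)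
      obtain ⟨S, hS, rfl⟩ := Multiset.exists_le_map_eq_of_le_map v T V hV
      have hSa : a * S.prod = a := by
        rw [hprod S hS, mul_comm]
        exact hVa
      obtain ⟨U, rfl⟩ := Multiset.le_iff_exists_add.1 hS
      refine ⟨U, Multiset.le_add_left _ _, ?_, ?_⟩
      · intro hU
        have := congrArg Multiset.card hU
        rw [Multiset.card_add] at this
        exact hV0 (by simp [Multiset.card_eq_zero.1 (show Multiset.card S = 0 by omega)])
      · rw [Multiset.prod_add, ← mul_assoc, hSa]
    · push Not at hdvd
      obtain ⟨b, hb, hab⟩ := hdvd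
      obtain ⟨u, hu, hu'⟩ := exists_annihilator_unit_of_not_dvd hc hc1 hab
      obtain ⟨T, rfl⟩ := Multiset.exists_cons_of_mem hb
      have hlt : MulAction.stabilizer Rˣ a < MulAction.stabilizer Rˣ (a * b) := by
        refine SetLike.lt_iff_le_and_exists.2 ⟨fun w hw => ?_, u, hu, hu'⟩
        rw [MulAction.mem_stabilizer_iff, Units.smul_def, smul_eq_mul] at hw ⊢
        rw [← mul_assoc, hw]
      obtain ⟨T', hle, hne, hT'⟩ := ih (a * b) (ha.of_lt hlt) T (by simpa using hT)
      refine ⟨b ::ₘ T', (Multiset.cons_le_cons_iff _).2 hle, fun h => hne (by simpa using h), ?_⟩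
      simpa [mul_assoc] using hT'

/-- If a finite commutative ring has a unit `c` such that `c - 1` is also a unit, then its
multiplicative monoid has the same Davenport constant as its group of units. -/
theorem davenport_eq_davenport_units {c : R} (hc : IsUnit c) (hc1 : IsUnit (c - 1)) :
    Davenport R = Davenport Rˣ := by
  unfold Davenport
  congr 1
  ext n
  refine and_congr_right fun _ => ⟨fun h T hT => ?_, fun h T hT => ?_⟩
  · obtain ⟨T', hle, hne, hprod⟩ := h (T.map Units.val) (by simpa using hT)
    obtain ⟨S, hS, rfl⟩ := Multiset.exists_le_map_eq_of_le_map _ T T' hle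
    refine ⟨S, hS, fun h => hne (by rw [h]), Units.ext ?_⟩
    exact ((Units.coeHom R).map_multiset_prod S).trans
      (hprod.trans ((Units.coeHom R).map_multiset_prod T).symm)
  · have hforces : (MulAction.stabilizer Rˣ (1 : R)).ForcesProd n := fun V hV => by
      obtain ⟨V', hle, hne, hprod⟩ := h V hV
      obtain ⟨W, rfl⟩ := Multiset.le_iff_exists_add.1 hle
      refine ⟨W, Multiset.le_add_left _ _, fun h => hne (by simp [h]), ?_⟩
      rw [Multiset.prod_add, left_eq_mul] at hprod
      rw [hprod]
      exact one_mem _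
    obtain ⟨T', hle, hne, hprod⟩ := exists_prod_eq_of_forcesProd hc hc1 n 1 hforces T hT
    exact ⟨T', hle, hne, by simpa using hprod⟩

end FiniteRing

/-- Let `q > 2` be a prime power, `F` the finite field with `q` elements, `f` a
nonconstant polynomial over `F`, and `R = F[x]/(f)`.  Then `D(S_R) = D(U(S_R))`. -/
theorem davenport_quotient_of_polynomial_ring (q : ℕ) (hq : IsPrimePow q) (hq2 : 2 < q)
    (F : Type*) [Field F] [Fintype F] (hcard : Fintype.card F = q)
    (f : Polynomial F) (hf : 0 < f.degree) :
    Davenport (Polynomial F ⧸ Ideal.span {f}) =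
      Davenport ((Polynomial F ⧸ Ideal.span {f})ˣ) := by
  classical
  have hf0 : f ≠ 0 := Polynomial.ne_zero_of_degree_gt hf
  have : Module.Finite F (Polynomial F ⧸ Ideal.span {f}) :=
    (AdjoinRoot.powerBasis hf0).finite
  have : Finite (Polynomial F ⧸ Ideal.span {f}) := Module.finite_of_finite F
  obtain ⟨c, hc⟩ : ∃ c, c ∉ ({0, 1} : Finset F) := by
    by_contra! h
    have h1 := Finset.card_le_card (fun x _ => h x : (Finset.univ : Finset F) ⊆ {0, 1})
    have h2 := Finset.card_le_two (a := (0 : F)) (b := 1)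
    rw [Finset.card_univ] at h1
    omega
  simp only [Finset.mem_insert, Finset.mem_singleton, not_or] at hc
  let φ := algebraMap F (Polynomial F ⧸ Ideal.span {f})
  refine davenport_eq_davenport_units (c := φ c) ((isUnit_iff_ne_zero.2 hc.1).map φ) ?_
  rw [← map_one φ, ← map_sub]
  exact (isUnit_iff_ne_zero.2 (sub_ne_zero.2 hc.2)).map φ
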